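/- (Theorem 1, structural form.) Let K ≥ 1, m, n be natural numbers. For each k ∈ Fin K let Lᵏ be an m×n real matrix and Tᵏ an m×3 real matrix. Define the real matrix J with row index type (Fin K × Fin m) ⊕ (Fin (K−1) × Fin 3) and column index type (Fin n) ⊕ (Fin K × Fin 3) by: J(inl(k,r), inl c) = Lᵏ(r,c); J(inl(k,r), inr(k',c)) = Tᵏ(r,c) if k' = k and 0 otherwise; J(inr(j,r), inl c) = 0; and J(inr(j,r), inr(k',c)) equals −1 if k' = j (as an element of Fin K via cast) and r = c, equals +1 if k' = j+1 and r = c, and 0 otherwise. Define F as the (K·m)×(n+3) matrix whose k-th row block is [Lᵏ Tᵏ], i.e., F((k,r), inl c) = Lᵏ(r,c) and F((k,r), inr c) = Tᵏ(r,c). Then J has full column rank (rank(J) = n + 3K) if and only if F has full column rank (rank(F) = n + 3). -/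

import Mathlib

open Matrix

theorem rank_eq_card_iff_ker {p q : Type} [Fintype p] [Fintype q]
    (A : Matrix p q ℝ) (N : ℕ) (hN : Fintype.card q = N) :
    A.rank = N ↔ ∀ v : q → ℝ, A *ᵥ v = 0 → v = 0 := by
  classical
  have h1 := LinearMap.finrank_range_add_finrank_ker A.mulVecLin
  rw [Module.finrank_fintype_fun_eq_card, hN] at h1
  have h2 : A.rank = N ↔ LinearMap.ker A.mulVecLin = ⊥ := by
    rw [← Submodule.finrank_eq_zero (R := ℝ)]
    unfold Matrix.rank
    omega
  rw [h2, LinearMap.ker_eq_bot']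
  simp

/-- Theorem 1 (structural form): the batch-SLAM Jacobian `J`, built from the blocks
`Lᵏ`, `Tᵏ` together with the odometry blocks `-I₃`, `I₃`, has full column rank
`n + 3K` iff the stacked matrix `F = [L T]` has full column rank `n + 3`. -/
theorem jacobian_full_column_rank_iff_F_full_column_rank
    (K m n : ℕ) (hK : 1 ≤ K)
    (L : Fin K → Matrix (Fin m) (Fin n) ℝ)
    (T : Fin K → Matrix (Fin m) (Fin 3) ℝ)
    (J : Matrix ((Fin K × Fin m) ⊕ (Fin (K - 1) × Fin 3)) ((Fin n) ⊕ (Fin K × Fin 3)) ℝ)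
    (hJ : ∀ row col, J row col =
      match row, col with
      | Sum.inl (k, r), Sum.inl c => L k r c
      | Sum.inl (k, r), Sum.inr (k', c) => if k' = k then T k r c else 0
      | Sum.inr (_, _), Sum.inl _ => 0
      | Sum.inr (j, r), Sum.inr (k', c) =>
          if k' = Fin.castLE (Nat.sub_le K 1) j ∧ r = c then -1
          else if (k' : ℕ) = (j : ℕ) + 1 ∧ r = c then 1 else 0)
    (F : Matrix (Fin K × Fin m) ((Fin n) ⊕ (Fin 3)) ℝ)
    (hF : ∀ row col, F row col =
      match row, col with
      | (k, r), Sum.inl c => L k r c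
      | (k, r), Sum.inr c => T k r c) :
    J.rank = n + 3 * K ↔ F.rank = n + 3 := by
  rw [rank_eq_card_iff_ker J (n + 3 * K) (by simp [mul_comm]),
    rank_eq_card_iff_ker F (n + 3) (by simp)]
  have hJ1 : ∀ v k r, (J *ᵥ v) (Sum.inl (k, r)) =
      ∑ c, L k r c * v (Sum.inl c) + ∑ c, T k r c * v (Sum.inr (k, c)) := by
    intro v k r
    simp [Matrix.mulVec, dotProduct, hJ, Fintype.sum_sum_type, Fintype.sum_prod_type, ite_mul]
  have hJ2 : ∀ v (j : Fin (K - 1)) r, (J *ᵥ v) (Sum.inr (j, r)) =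
      v (Sum.inr (⟨j + 1, by omega⟩, r)) - v (Sum.inr (⟨j, by omega⟩, r)) := by
    intro v j r
    have key : ∀ (k' : Fin K) (c : Fin 3), J (Sum.inr (j, r)) (Sum.inr (k', c)) =
        (if k' = ⟨j + 1, by omega⟩ then (if r = c then 1 else 0) else 0)
          - (if k' = ⟨j, by omega⟩ then (if r = c then 1 else 0) else 0) := by
      intro k' c
      rw [hJ]
      simp only [Fin.ext_iff, Fin.val_castLE]
      by_cases h : r.val = c.val <;> by_cases h1 : k'.val = j.val <;>
        by_cases h2 : k'.val = j.val + 1 <;> simp_all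
    have key0 : ∀ c, J (Sum.inr (j, r)) (Sum.inl c) = 0 := fun c => by rw [hJ]
    simp only [Matrix.mulVec, dotProduct, Fintype.sum_sum_type, Fintype.sum_prod_type, key, key0]
    rw [Finset.sum_comm]
    simp [sub_mul, Finset.sum_sub_distrib, ite_mul]
  have hF1 : ∀ v k r, (F *ᵥ v) (k, r) =
      ∑ c, L k r c * v (Sum.inl c) + ∑ c, T k r c * v (Sum.inr c) := by
    intro v k r
    simp [Matrix.mulVec, dotProduct, hF, Fintype.sum_sum_type]
  constructor
  · intro H w hw
    have h := H (Sum.elim (fun c => w (Sum.inl c)) (fun p => w (Sum.inr p.2))) (by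
      funext row
      rcases row with ⟨k, r⟩ | ⟨j, r⟩
      · have := congrFun hw (k, r)
        rw [hF1] at this
        rw [hJ1]
        simpa using this
      · rw [hJ2]
        simp)
    funext col
    rcases col with c | c
    · simpa using congrFun h (Sum.inl c)
    · simpa using congrFun h (Sum.inr (⟨0, hK⟩, c))
  · intro H v hv
    have hconst : ∀ (i : ℕ) (hi : i < K) c, v (Sum.inr (⟨i, hi⟩, c)) = v (Sum.inr (⟨0, hK⟩, c)) := by
      intro i
      induction i with
      | zero => intro _ _; rfl
      | succ i ih =>
        intro hi c
        have h := congrFun hv (Sum.inr (⟨i, by omega⟩, c))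
        rw [hJ2] at h
        rw [← ih (by omega) c]
        simpa [sub_eq_zero] using h
    have h := H (Sum.elim (fun c => v (Sum.inl c)) (fun c => v (Sum.inr (⟨0, hK⟩, c)))) (by
      funext ⟨k, r⟩
      have h := congrFun hv (Sum.inl (k, r))
      rw [hJ1] at h
      rw [hF1]
      have hc : ∀ c, v (Sum.inr (k, c)) = v (Sum.inr (⟨0, hK⟩, c)) := fun c => hconst k.1 k.2 c
      simpa [hc] using h)
    funext col
    rcases col with c | ⟨k, c⟩
    · simpa using congrFun h (Sum.inl c)
    · have := congrFun h (Sum.inr c)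
      rw [show v (Sum.inr (k, c)) = _ from hconst k.1 k.2 c]
      simpa using this
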